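/- The class of data languages accepted by SAFA is closed under concatenation: for any two SAFA M1 and M2 over the same Σ × D, there exists a SAFA M with L(M) = L(M1)·L(M2), the set of all concatenations u·v with u ∈ L(M1) and v ∈ L(M2). -/

import Mathlib

/-- A condition tested by a SAFA transition: membership (`pos h` = `p(h)`)
or non-membership (`neg h` = `!p(h)`) of the current data value in set `h`. -/
inductive SafaCond (H : Type) : Type
  | pos (h : H)
  | neg (h : H)

/-- The set name a condition refers to. -/
def SafaCond.name {H : Type} : SafaCond H → H
  | .pos h => h
  | .neg h => h

/-- An operation of a SAFA transition: do nothing (`−`) or insert the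
current data value into set `h` (`ins(h)`). -/
inductive SafaOp (H : Type) : Type
  | noop
  | ins (h : H)

/-- Whether a condition holds for data value `d` given set contents `s`. -/
def SafaCond.holds {H D : Type} : SafaCond H → D → (H → Set D) → Prop
  | .pos h, d, s => d ∈ s h
  | .neg h, d, s => d ∉ s h

/-- The effect of an operation on the set contents, reading data value `d`. -/
def SafaOp.apply {H D : Type} : SafaOp H → D → (H → Set D) → (H → Set D)
  | .noop, _, s => s
  | .ins h, d, s => fun j => s j ∪ {x | j = h ∧ x = d}

/-- A transition of a SAFA: source state, attribute, condition, operation, target state. -/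
structure SafaTrans (Q A H : Type) : Type where
  src : Q
  attr : A
  cond : SafaCond H
  op : SafaOp H
  dst : Q

/-- A set augmented finite automaton over attributes `A` and data values `D`:
a finite set of states `Q` with initial state `q0` and final states `F`,
a finite collection `H` of set names, and a transition relation `δ`. -/
structure SAFA (A D : Type) : Type 1 where
  Q : Type
  fintypeQ : Fintype Q
  q0 : Q
  F : Set Q
  H : Type
  fintypeH : Fintype H
  δ : Set (SafaTrans Q A H)

attribute [instance] SAFA.fintypeQ SAFA.fintypeH

namespace SAFA

variable {A D : Type}

/-- A configuration: a state together with the current contents of the sets. -/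
abbrev Config (M : SAFA A D) : Type := M.Q × (M.H → Set D)

/-- The initial configuration: initial state, all sets empty. -/
def init (M : SAFA A D) : M.Config := (M.q0, fun _ => ∅)

/-- One step: from configuration `c`, taking transition `t` while reading letter `ad`,
reaching configuration `c'`. -/
def StepVia (M : SAFA A D) (c : M.Config) (t : SafaTrans M.Q A M.H)
    (ad : A × D) (c' : M.Config) : Prop :=
  t ∈ M.δ ∧ t.src = c.1 ∧ t.attr = ad.1 ∧ t.dst = c'.1 ∧
    t.cond.holds ad.2 c.2 ∧ c'.2 = t.op.apply ad.2 c.2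

/-- Execution of a sequence of transitions `T` reading the data word `w`,
from configuration `c` to configuration `c'`. -/
inductive ExecFrom (M : SAFA A D) :
    M.Config → List (SafaTrans M.Q A M.H) → List (A × D) → M.Config → Prop
  | nil (c : M.Config) : ExecFrom M c [] [] c
  | cons {c c' c'' : M.Config} {t : SafaTrans M.Q A M.H}
      {ts : List (SafaTrans M.Q A M.H)} {ad : A × D} {w : List (A × D)} :
      M.StepVia c t ad c' → ExecFrom M c' ts w c'' → ExecFrom M c (t :: ts) (ad :: w) c''

/-- Acceptance: some run from the initial configuration consumes all of `w`
and ends in a final state. -/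
def Accepts (M : SAFA A D) (w : List (A × D)) : Prop :=
  ∃ T c, M.ExecFrom M.init T w c ∧ c.1 ∈ M.F

/-- The data language accepted by `M`. -/
def Lang (M : SAFA A D) : Set (List (A × D)) := {w | M.Accepts w}

/-- A SAFA is deterministic if, for every state and attribute, all outgoing
transitions test membership in one and the same set, with at most one transition
per polarity of the condition. -/
def IsDeterministic (M : SAFA A D) : Prop :=
  ∀ t1 t2 : SafaTrans M.Q A M.H, t1 ∈ M.δ → t2 ∈ M.δ →
    t1.src = t2.src → t1.attr = t2.attr →
    t1.cond.name = t2.cond.name ∧ (t1.cond = t2.cond → t1 = t2)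

end SAFA

namespace SafaCond

/-- Rename the set a condition refers to. -/
def map {H K : Type} (f : H → K) : SafaCond H → SafaCond K
  | .pos h => .pos (f h)
  | .neg h => .neg (f h)

theorem holds_map {H K D : Type} (f : H → K) (c : SafaCond H) (d : D) (s : K → Set D) :
    (c.map f).holds d s ↔ c.holds d (s ∘ f) := by
  cases c <;> rfl

end SafaCond

namespace SafaOp

/-- Rename the set an operation inserts into. -/
def map {H K : Type} (f : H → K) : SafaOp H → SafaOp K
  | .noop => .noop
  | .ins h => .ins (f h)

theorem apply_map_inl {H K D : Type} (o : SafaOp H) (d : D) (s : H → Set D) (r : K → Set D) :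
    (o.map Sum.inl).apply d (Sum.elim s r) = Sum.elim (o.apply d s) r := by
  cases o
  · rfl
  · funext j
    cases j <;> simp [map, apply]

theorem apply_map_inr {H K D : Type} (o : SafaOp K) (d : D) (s : H → Set D) (r : K → Set D) :
    (o.map Sum.inr).apply d (Sum.elim s r) = Sum.elim s (o.apply d r) := by
  cases o
  · rfl
  · funext j
    cases j <;> simp [map, apply]

end SafaOp

/-- Rename the states and set names of a transition. -/
def SafaTrans.map {Q R A H K : Type} (g : Q → R) (f : H → K) (t : SafaTrans Q A H) :
    SafaTrans R A K :=
  ⟨g t.src, t.attr, t.cond.map f, t.op.map f, g t.dst⟩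

namespace SAFA

variable {A D : Type}

/-- Acceptance of a word from an arbitrary configuration. -/
def AcceptsFrom (M : SAFA A D) (c : M.Config) (w : List (A × D)) : Prop :=
  ∃ T c', M.ExecFrom c T w c' ∧ c'.1 ∈ M.F

theorem acceptsFrom_nil (M : SAFA A D) (c : M.Config) : M.AcceptsFrom c [] ↔ c.1 ∈ M.F := by
  constructor
  · rintro ⟨_, _, ⟨⟩, h⟩
    exact h
  · exact fun h => ⟨[], c, .nil c, h⟩

theorem acceptsFrom_cons (M : SAFA A D) (c : M.Config) (a : A × D) (w : List (A × D)) :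
    M.AcceptsFrom c (a :: w) ↔ ∃ t ∈ M.δ, t.src = c.1 ∧ t.attr = a.1 ∧ t.cond.holds a.2 c.2 ∧
      M.AcceptsFrom (t.dst, t.op.apply a.2 c.2) w := by
  constructor
  · rintro ⟨_, e, h, hF⟩
    cases h with
    | @cons _ c' _ t ts _ _ hs hr =>
      obtain ⟨ht, hsrc, hattr, hdst, hc, hop⟩ := hs
      refine ⟨t, ht, hsrc, hattr, hc, ts, e, ?_, hF⟩
      rwa [hdst, ← hop]
  · rintro ⟨t, ht, hsrc, hattr, hc, ts, e, hr, hF⟩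
    exact ⟨t :: ts, e, .cons ⟨ht, hsrc, hattr, rfl, hc, rfl⟩ hr, hF⟩

/-- The concatenation automaton: it runs `M1`, and from a final state of `M1` may move on with a
transition of `M2` that leaves the initial state of `M2`. The two automata use disjoint sets. -/
def concat (M1 M2 : SAFA A D) : SAFA A D where
  Q := M1.Q ⊕ M2.Q
  fintypeQ := inferInstance
  q0 := .inl M1.q0
  F := {q | Sum.elim (fun q => q ∈ M1.F ∧ M2.q0 ∈ M2.F) (· ∈ M2.F) q}
  H := M1.H ⊕ M2.H
  fintypeH := inferInstance
  δ := {t | (∃ t1 ∈ M1.δ, t = t1.map .inl .inl) ∨ (∃ t2 ∈ M2.δ, t = t2.map .inr .inr) ∨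
    ∃ q ∈ M1.F, ∃ t2 ∈ M2.δ, t2.src = M2.q0 ∧
      t = { t2.map Sum.inr Sum.inr with src := .inl q }}

variable (M1 M2 : SAFA A D)

theorem concat_acceptsFrom_inr (w : List (A × D)) (q : M2.Q) (s : M1.H → Set D)
    (r : M2.H → Set D) :
    (M1.concat M2).AcceptsFrom (.inr q, Sum.elim s r) w ↔ M2.AcceptsFrom (q, r) w := by
  induction w generalizing q r with
  | nil => simp only [acceptsFrom_nil]; rfl
  | cons a w ih =>
    simp only [acceptsFrom_cons]
    constructor
    · rintro ⟨_, ⟨t, ht, rfl⟩ | ⟨t, ht, rfl⟩ | ⟨p, hp, t, ht, h0, rfl⟩, hsrc, hattr, hc, hr⟩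
      · cases hsrc
      · refine ⟨t, ht, Sum.inr_injective hsrc, hattr,
          (SafaCond.holds_map Sum.inr t.cond a.2 (Sum.elim s r)).1 hc, ?_⟩
        rw [← ih, ← SafaOp.apply_map_inr]
        exact hr
      · cases hsrc
    · rintro ⟨t, ht, hsrc, hattr, hc, hr⟩
      refine ⟨t.map .inr .inr, .inr (.inl ⟨t, ht, rfl⟩), congrArg Sum.inr hsrc, hattr,
        (SafaCond.holds_map _ _ _ _).2 hc, ?_⟩
      rw [← ih, ← SafaOp.apply_map_inr] at hr
      exact hr

theorem concat_acceptsFrom_inl (w : List (A × D)) (q : M1.Q) (s : M1.H → Set D) :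
    (M1.concat M2).AcceptsFrom (.inl q, Sum.elim s fun _ => ∅) w ↔
      ∃ u v, w = u ++ v ∧ M1.AcceptsFrom (q, s) u ∧ M2.AcceptsFrom M2.init v := by
  induction w generalizing q s with
  | nil =>
    simp only [acceptsFrom_nil, List.nil_eq_append_iff]
    constructor
    · rintro ⟨h1, h2⟩
      exact ⟨[], [], ⟨rfl, rfl⟩, (acceptsFrom_nil ..).2 h1, (acceptsFrom_nil ..).2 h2⟩
    · rintro ⟨_, _, ⟨rfl, rfl⟩, h1, h2⟩
      exact ⟨(acceptsFrom_nil ..).1 h1, (acceptsFrom_nil ..).1 h2⟩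
  | cons a w ih =>
    rw [acceptsFrom_cons]
    constructor
    · rintro ⟨_, ⟨t, ht, rfl⟩ | ⟨t, ht, rfl⟩ | ⟨p, hp, t, ht, h0, rfl⟩, hsrc, hattr, hc, hr⟩
      · have hr' : (M1.concat M2).AcceptsFrom
            (.inl t.dst, (t.op.map Sum.inl).apply a.2 (Sum.elim s fun _ => ∅)) w := hr
        rw [SafaOp.apply_map_inl, ih] at hr'
        obtain ⟨u, v, rfl, hu, hv⟩ := hr'
        exact ⟨a :: u, v, rfl, (acceptsFrom_cons ..).2 ⟨t, ht, Sum.inl_injective hsrc, hattr,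
          (SafaCond.holds_map Sum.inl t.cond a.2 (Sum.elim s fun _ => ∅)).1 hc, hu⟩, hv⟩
      · cases hsrc
      · cases hsrc
        refine ⟨[], a :: w, rfl, (acceptsFrom_nil ..).2 hp, (acceptsFrom_cons ..).2
          ⟨t, ht, h0, hattr,
            (SafaCond.holds_map Sum.inr t.cond a.2 (Sum.elim s fun _ => ∅)).1 hc, ?_⟩⟩
        rw [← concat_acceptsFrom_inr M1 M2 w _ s, ← SafaOp.apply_map_inr]
        exact hr
    · rintro ⟨u, v, h, hu, hv⟩
      rcases List.cons_eq_append_iff.1 h with ⟨rfl, rfl⟩ | ⟨u, rfl, rfl⟩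
      · obtain ⟨t, ht, hsrc, hattr, hc, hr⟩ := (acceptsFrom_cons ..).1 hv
        refine ⟨{ t.map Sum.inr Sum.inr with src := .inl q },
          .inr (.inr ⟨q, (acceptsFrom_nil ..).1 hu, t, ht, hsrc, rfl⟩), rfl, hattr,
          (SafaCond.holds_map _ _ _ _).2 hc, ?_⟩
        rw [← concat_acceptsFrom_inr M1 M2 w _ s, ← SafaOp.apply_map_inr] at hr
        exact hr
      · obtain ⟨t, ht, hsrc, hattr, hc, hr⟩ := (acceptsFrom_cons ..).1 hu
        refine ⟨t.map .inl .inl, .inl ⟨t, ht, rfl⟩, congrArg Sum.inl hsrc, hattr,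
          (SafaCond.holds_map _ _ _ _).2 hc, ?_⟩
        have hr' := (ih _ _).2 ⟨u, v, rfl, hr, hv⟩
        rw [← SafaOp.apply_map_inl] at hr'
        exact hr'

theorem lang_concat :
    (M1.concat M2).Lang = {w | ∃ u ∈ M1.Lang, ∃ v ∈ M2.Lang, w = u ++ v} := by
  ext w
  have hinit : (M1.concat M2).init = (.inl M1.q0, Sum.elim (fun _ => ∅) fun _ => ∅) :=
    Prod.ext rfl (funext fun j => by cases j <;> rfl)
  change (M1.concat M2).AcceptsFrom (M1.concat M2).init w ↔ _
  rw [hinit]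
  refine (concat_acceptsFrom_inl M1 M2 w M1.q0 fun _ => ∅).trans ?_
  constructor
  · rintro ⟨u, v, h, hu, hv⟩
    exact ⟨u, hu, v, hv, h⟩
  · rintro ⟨u, hu, v, hv, h⟩
    exact ⟨u, v, h, hu, hv⟩

end SAFA


/-- SAFA languages are closed under concatenation. -/
theorem safa_closed_concat {A D : Type} [Fintype A] [Countable D] [Infinite D]
    (M1 M2 : SAFA A D) :
    ∃ M : SAFA A D, M.Lang = {w | ∃ u ∈ M1.Lang, ∃ v ∈ M2.Lang, w = u ++ v} := by
  exact ⟨M1.concat M2, SAFA.lang_concat M1 M2⟩
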